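/- For every bivalued instance with equal weights w_i = 1/|N| there exists an allocation X that is both EQX and fPO; that is, v_i(X_i) ≥ v_j(X_j ∖ {e}) for all agents i, j and every good e ∈ X_j, and no fractional allocation dominates X. -/

import Mathlib

open Finset

/-- `X` is an allocation: bundles are pairwise disjoint and cover all goods. -/
def IsAllocation {N M : Type*} (X : N → Finset M) : Prop :=
  (∀ i j : N, i ≠ j → Disjoint (X i) (X j)) ∧ ∀ e : M, ∃ i : N, e ∈ X i

/-- A fractional allocation: entries in `[0,1]`, each good fully distributed. -/
def IsFracAlloc {N M : Type*} [Fintype N] (x : N → M → ℝ) : Prop :=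
  (∀ i e, 0 ≤ x i e ∧ x i e ≤ 1) ∧ ∀ e : M, ∑ i : N, x i e = 1

/-- Fractional allocation `x` dominates allocation `X`. -/
def FracDominates {N M : Type*} [Fintype M] (v : N → M → ℝ) (x : N → M → ℝ)
    (X : N → Finset M) : Prop :=
  (∀ i, ∑ e ∈ X i, v i e ≤ ∑ e : M, x i e * v i e) ∧
    ∃ i, ∑ e ∈ X i, v i e < ∑ e : M, x i e * v i e

/-- `X` is fractionally Pareto optimal. -/
def IsfPO {N M : Type*} [Fintype N] [Fintype M] (v : N → M → ℝ) (X : N → Finset M) : Prop :=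
  ¬ ∃ x : N → M → ℝ, IsFracAlloc x ∧ FracDominates v x X

/-- `(X, p)` is a Fisher market equilibrium: every agent only holds goods that
maximize her bang-per-buck ratio. -/
def IsEquilibrium {N M : Type*} (v : N → M → ℝ) (p : M → ℝ) (X : N → Finset M) : Prop :=
  ∀ i : N, ∀ e ∈ X i, ∀ e' : M, v i e' / p e' ≤ v i e / p e

/-- `X` is weighted envy-free up to any good. -/
def IsWEFX {N M : Type*} [DecidableEq M] (v : N → M → ℝ) (w : N → ℝ) (X : N → Finset M) : Prop :=
  ∀ i j : N, ∀ e ∈ X j, (∑ a ∈ (X j).erase e, v i a) / w j ≤ (∑ a ∈ X i, v i a) / w i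

/-- `X` is weighted equitable up to any good. -/
def IsWEQX {N M : Type*} [DecidableEq M] (v : N → M → ℝ) (w : N → ℝ) (X : N → Finset M) : Prop :=
  ∀ i j : N, ∀ e ∈ X j, (∑ a ∈ (X j).erase e, v j a) / w j ≤ (∑ a ∈ X i, v i a) / w i

namespace BivaluedEQX

variable {N M : Type*} {k : ℝ} {v : N → M → ℝ}

open scoped Classical in
/-- Utility of agent `x` when good `e` is owned by `f e`. -/
noncomputable def util [Fintype M] (v : N → M → ℝ) (f : M → N) (x : N) : ℝ :=
  ∑ e, if f e = x then v x e else 0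

/-- The agents in `H` have multiplier `k`, the others multiplier `1`, and every good is owned by an
agent maximizing multiplier times value. -/
structure Supports (k : ℝ) (v : N → M → ℝ) (H : Set N) (f : M → N) : Prop where
  nonempty : H.Nonempty
  high : ∀ e, ∀ h ∈ H, v h e = k → f e ∈ H ∧ v (f e) e = k
  low : ∀ e, f e ∉ H → v (f e) e = k

/-- Agent `x` owns a good that both `x` and `y` value `k`, and `x`, `y` have equal multipliers. -/
def Edge (k : ℝ) (v : N → M → ℝ) (H : Set N) (f : M → N) (x y : N) : Prop :=
  (x ∈ H ↔ y ∈ H) ∧ ∃ e, f e = x ∧ v x e = k ∧ v y e = k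

open scoped Classical in
lemma util_update [Fintype M] (f : M → N) (e : M) (y x : N) :
    util v (Function.update f e y) x =
      util v f x + (if x = y then v x e else 0) - (if x = f e then v x e else 0) := by
  have h : util v (Function.update f e y) x - util v f x =
      (if x = y then v x e else 0) - (if x = f e then v x e else 0) := by
    unfold util
    rw [← Finset.sum_sub_distrib, Finset.sum_eq_single e]
    · simp [eq_comm]
    · intro b _ hb
      simp [Function.update_of_ne hb]
    · simp
  linarith

open scoped Classical in
lemma Supports.update {H : Set N} {f : M → N} (hs : Supports k v H f) {e : M} {y : N}
    (h1 : ∀ h ∈ H, v h e = k → y ∈ H ∧ v y e = k) (h2 : y ∉ H → v y e = k) :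
    Supports k v H (Function.update f e y) := by
  refine ⟨hs.nonempty, fun e' h hh hv => ?_, fun e' he' => ?_⟩
  · by_cases he : e' = e
    · subst he
      simpa using h1 h hh hv
    · simpa [Function.update_of_ne he] using hs.high e' h hh hv
  · by_cases he : e' = e
    · subst he
      simp only [Function.update_self] at he' ⊢
      exact h2 he'
    · simp only [Function.update_of_ne he] at he' ⊢
      exact hs.low e' he'

open Relation in
/-- A path can be rerouted to leave its start `a` once and never have `a` as a source again. -/
lemma exists_step_avoiding {r : N → N → Prop} {a b x : N} (hab : a ≠ b)
    (h : ReflTransGen r x b) :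
    ReflTransGen (fun x y => r x y ∧ x ≠ a) x b ∨
      ∃ c, r a c ∧ ReflTransGen (fun x y => r x y ∧ x ≠ a) c b := by
  induction h using ReflTransGen.head_induction_on with
  | refl => exact Or.inl .refl
  | @head x y hxy _ ih =>
    rcases ih with ih | ih
    · by_cases hx : x = a
      · subst hx
        exact Or.inr ⟨y, hxy, ih⟩
      · exact Or.inl (.head ⟨hxy, hx⟩ ih)
    · exact Or.inr ih

open Relation in
lemma reflTransGen_sources_reach {r : N → N → Prop} {a b : N} (h : ReflTransGen r a b) :
    ReflTransGen (fun x y => r x y ∧ ReflTransGen r x b) a b := by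
  induction h using ReflTransGen.head_induction_on with
  | refl => exact .refl
  | head hxy hyb ih => exact .head ⟨hxy, .head hxy hyb⟩ ih

open Relation in
open scoped Classical in
/-- Passing goods along a path of edges from `a` to `b` moves utility `k` from `a` to `b`. -/
lemma exists_shift [Fintype M] {H : Set N} (A : Finset N) :
    ∀ {f : M → N} {a b : N}, Supports k v H f →
    ReflTransGen (fun x y => Edge k v H f x y ∧ x ∈ A) a b →
    ∃ f', Supports k v H f' ∧
      (∀ x, util v f' x = util v f x + (if x = b then k else 0) - (if x = a then k else 0)) ∧
      ∀ e, f' e ≠ f e → f e ∈ A ∧ v (f e) e = k := by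
  induction A using Finset.strongInduction with
  | H A ih =>
    intro f a b hs hp
    by_cases hab : a = b
    · subst hab
      exact ⟨f, hs, fun x => by ring, fun e he => absurd rfl he⟩
    obtain ⟨c, ⟨⟨hHac, e, hfe, hva, hvc⟩, haA⟩, hp'⟩ :
        ∃ c, (Edge k v H f a c ∧ a ∈ A) ∧
          ReflTransGen (fun x y => (Edge k v H f x y ∧ x ∈ A) ∧ x ≠ a) c b := by
      rcases exists_step_avoiding hab hp with h | h
      · rcases h.cases_head with h | ⟨c, h, _⟩
        · exact absurd h hab
        · exact absurd rfl h.2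
      · exact h
    have hs' : Supports k v H (Function.update f e c) := by
      refine hs.update (fun h hh hv => ⟨?_, hvc⟩) (fun _ => hvc)
      have := (hs.high e h hh hv).1
      rw [hfe] at this
      exact hHac.1 this
    have hp'' : ReflTransGen
        (fun x y => Edge k v H (Function.update f e c) x y ∧ x ∈ A.erase a) c b := by
      refine ReflTransGen.mono ?_ _ _ hp'
      rintro x y ⟨⟨⟨hxy, g, hg, hgx, hgy⟩, hxA⟩, hxa⟩
      refine ⟨⟨hxy, g, ?_, hgx, hgy⟩, Finset.mem_erase.2 ⟨hxa, hxA⟩⟩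
      have hge : g ≠ e := by
        rintro rfl
        exact hxa (hg.symm.trans hfe)
      rw [Function.update_of_ne hge, hg]
    obtain ⟨f', hf's, hf'u, hf'm⟩ := ih _ (Finset.erase_ssubset haA) hs' hp''
    refine ⟨f', hf's, fun x => ?_, fun e' he' => ?_⟩
    · rw [hf'u, util_update, hfe]
      have h1 : (if x = c then v x e else 0) = if x = c then k else 0 := by
        split_ifs with h
        · rw [h, hvc]
        · rfl
      have h2 : (if x = a then v x e else 0) = if x = a then k else 0 := by
        split_ifs with h
        · rw [h, hva]
        · rfl
      rw [h1, h2]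
      ring
    · by_cases hee : e' = e
      · subst hee
        rw [hfe]
        exact ⟨haA, hva⟩
      · have := hf'm e'
        rw [Function.update_of_ne hee] at this
        exact ⟨Finset.mem_of_mem_erase (this he').1, (this he').2⟩

open Relation in
open scoped Classical in
/-- A good that no agent of `H` values `k` can be taken from its owner so that `i` gains at least
`1` and nobody else loses. -/
lemma exists_improvement_of_cheap [Fintype N] [Fintype M] (hk : 1 < k)
    (hv : ∀ i e, v i e = 1 ∨ v i e = k)
    {H : Set N} {f : M → N} (hs : Supports k v H f) (e : M) (he : ∀ h ∈ H, v h e ≠ k) (i : N) :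
    ∃ H' f', Supports k v H' f' ∧
      ∀ x, util v f x + (if x = i then 1 else 0) - (if x = f e then v x e else 0) ≤
        util v f' x := by
  have hv1 : ∀ x e, 1 ≤ v x e := fun x e => by rcases hv x e with h | h <;> linarith
  by_cases hi : i ∈ H
  · refine ⟨H, Function.update f e i, hs.update (fun h hh hvh => absurd hvh (he h hh))
      (fun h => absurd hi h), fun x => ?_⟩
    rw [util_update]
    have := hv1 x e
    split_ifs <;> linarith
  have low_of_reach : ∀ x, ReflTransGen (Edge k v H f) x i → x ∉ H := by
    intro x hx
    induction hx using ReflTransGen.head_induction_on with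
    | refl => exact hi
    | head hxy _ ih => exact fun h => ih (hxy.1.1 h)
  by_cases hfe : ReflTransGen (Edge k v H f) (f e) i
  · obtain ⟨f', hf's, hf'u, -⟩ := exists_shift (A := Finset.univ) hs
      (ReflTransGen.mono (fun x y h => ⟨h, Finset.mem_univ x⟩) _ _ hfe)
    refine ⟨H, f', hf's, fun x => ?_⟩
    rw [hf'u]
    have h2 : (if x = f e then v x e else 0) = if x = f e then k else 0 := by
      split_ifs with h
      · rw [h]
        exact hs.low e (low_of_reach _ hfe)
      · rfl
    rw [h2]
    split_ifs <;> linarith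
  by_cases hg : ∃ g s, ReflTransGen (Edge k v H f) s i ∧ f g ∈ H ∧ v s g = k ∧ v (f g) g ≠ k
  · obtain ⟨g, s, hsi, hgH, hsg, hgk⟩ := hg
    have hg1 : v (f g) g = 1 := (hv _ _).resolve_right hgk
    have hgc : ∀ h ∈ H, v h g ≠ k := fun h hh hvh => hgk (hs.high g h hh hvh).2
    obtain ⟨f₁, hf₁s, hf₁u, hf₁m⟩ := exists_shift
      (A := Finset.univ.filter fun x => ReflTransGen (Edge k v H f) x i) hs
      (ReflTransGen.mono (fun x y h => ⟨h.1, by simpa using h.2⟩) _ _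
        (reflTransGen_sources_reach hsi))
    have hf₁g : f₁ g = f g := by
      by_contra h
      exact hgk (hf₁m g h).2
    have hf₁e : f₁ e = f e := by
      by_contra h
      exact hfe (by simpa using (hf₁m e h).1)
    have hf₂s : Supports k v H (Function.update f₁ g s) :=
      hf₁s.update (fun h hh hvh => absurd hvh (hgc h hh)) (fun _ => hsg)
    have hf₂u : ∀ x, util v (Function.update f₁ g s) x =
        util v f x + (if x = i then k else 0) - (if x = f g then 1 else 0) := by
      intro x
      rw [util_update, hf₁u, hf₁g]
      have h1 : (if x = s then v x g else 0) = if x = s then k else 0 := by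
        split_ifs with h
        · rw [h, hsg]
        · rfl
      have h2 : (if x = f g then v x g else 0) = if x = f g then 1 else 0 := by
        split_ifs with h
        · rw [h, hg1]
        · rfl
      rw [h1, h2]
      ring
    by_cases heg : e = g
    · subst heg
      refine ⟨H, _, hf₂s, fun x => ?_⟩
      rw [hf₂u]
      have := hv1 x e
      split_ifs <;> linarith
    · refine ⟨H, Function.update (Function.update f₁ g s) e (f g),
        hf₂s.update (fun h hh hvh => absurd hvh (he h hh)) (fun h => absurd hgH h), fun x => ?_⟩
      rw [util_update, hf₂u, Function.update_of_ne heg, hf₁e]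
      have := hv1 x e
      split_ifs <;> linarith
  · push Not at hg
    have hs' : Supports k v (H ∪ {x | ReflTransGen (Edge k v H f) x i}) f := by
      refine ⟨hs.nonempty.mono Set.subset_union_left, ?_, ?_⟩
      · rintro g h (hh | hh) hvh
        · exact ⟨Or.inl (hs.high g h hh hvh).1, (hs.high g h hh hvh).2⟩
        · by_cases hgH : f g ∈ H
          · exact ⟨Or.inl hgH, hg g h hh hgH hvh⟩
          · have hgk := hs.low g hgH
            exact ⟨Or.inr (.head ⟨iff_of_false hgH (low_of_reach h hh), g, rfl, hgk, hvh⟩ hh), hgk⟩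
      · exact fun g hgn => hs.low g fun h => hgn (Or.inl h)
    refine ⟨_, Function.update f e i, hs'.update ?_ (fun h => absurd (Or.inr .refl) h), fun x => ?_⟩
    · rintro h (hh | hh) hvh
      · exact absurd hvh (he h hh)
      · have hk' := (hs'.high e h (Or.inr hh) hvh)
        rcases hk'.1 with h' | h'
        · exact absurd hk'.2 (he _ h')
        · exact absurd h' hfe
    · rw [util_update]
      have := hv1 x e
      split_ifs <;> linarith

open Relation in
open scoped Classical in
/-- Any good can be taken from its owner so that `i` gains at least `1` and nobody else loses. -/
lemma exists_improvement [Fintype N] [Fintype M] (hk : 1 < k) (hv : ∀ i e, v i e = 1 ∨ v i e = k)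
    {H : Set N} {f : M → N} (hs : Supports k v H f) (e : M) (i : N) :
    ∃ H' f', Supports k v H' f' ∧
      ∀ x, util v f x + (if x = i then 1 else 0) - (if x = f e then v x e else 0) ≤
        util v f' x := by
  wlog hHsmall : i ∈ H ∨ ∃ g, v (f g) g ≠ k generalizing H
  · push Not at hHsmall
    exact this (H := Set.univ)
      ⟨⟨i, trivial⟩, fun g _ _ _ => ⟨trivial, hHsmall.2 g⟩, fun g _ => hHsmall.2 g⟩
      (Or.inl trivial)
  by_cases he : ∀ h ∈ H, v h e ≠ k
  · exact exists_improvement_of_cheap hk hv hs e he i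
  push Not at he
  obtain ⟨h, hh, hvh⟩ := he
  obtain ⟨hjH, hjk⟩ := hs.high e h hh hvh
  have hlose : ∀ x, (if x = f e then v x e else 0) = if x = f e then k else 0 := by
    intro x
    split_ifs with h
    · rw [h, hjk]
    · rfl
  have hshift : ∀ y, ReflTransGen (Edge k v H f) (f e) y → _ := fun y hy =>
    exists_shift (A := Finset.univ) hs
      (ReflTransGen.mono (fun x y h => ⟨h, Finset.mem_univ x⟩) _ _ hy)
  by_cases hi : ReflTransGen (Edge k v H f) (f e) i
  · obtain ⟨f', hf's, hf'u, -⟩ := hshift i hi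
    refine ⟨H, f', hf's, fun x => ?_⟩
    rw [hf'u, hlose]
    split_ifs <;> linarith
  by_cases hsmall : ∃ g, ReflTransGen (Edge k v H f) (f e) (f g) ∧ v (f g) g ≠ k
  · obtain ⟨g, hg, hgk⟩ := hsmall
    obtain ⟨f₁, hf₁s, hf₁u, hf₁m⟩ := hshift _ hg
    have hf₁g : f₁ g = f g := by
      by_contra h
      exact hgk (hf₁m g h).2
    obtain ⟨H', f', hf's, hf'u⟩ := exists_improvement_of_cheap hk hv hf₁s g
      (fun h hh hvh => hgk (hs.high g h hh hvh).2) i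
    refine ⟨H', f', hf's, fun x => ?_⟩
    have h1 := hf'u x
    rw [hf₁u, hf₁g] at h1
    have h2 : (if x = f g then v x g else 0) = if x = f g then 1 else 0 := by
      split_ifs with h
      · rw [h]
        exact (hv _ _).resolve_right hgk
      · rfl
    rw [hlose]
    rw [h2] at h1
    split_ifs at h1 ⊢ <;> linarith
  · push Not at hsmall
    have hs' : Supports k v (H \ {x | ReflTransGen (Edge k v H f) (f e) x}) f := by
      refine ⟨?_, ?_, ?_⟩
      · rcases hHsmall with h | ⟨g, hg⟩
        · exact ⟨i, h, hi⟩
        · refine ⟨f g, ?_, fun h => hg (hsmall g h)⟩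
          by_contra h
          exact hg (hs.low g h)
      · rintro g x ⟨hxH, hx⟩ hvx
        have := hs.high g x hxH hvx
        exact ⟨⟨this.1, fun h => hx (.tail h ⟨iff_of_true this.1 hxH, g, rfl, this.2, hvx⟩)⟩, this.2⟩
      · intro g hg
        by_cases hgH : f g ∈ H
        · refine hsmall g ?_
          by_contra h
          exact hg ⟨hgH, h⟩
        · exact hs.low g hgH
    refine exists_improvement_of_cheap hk hv hs' e ?_ i
    rintro x ⟨hxH, hx⟩ hvx
    exact hx (.single ⟨iff_of_true hjH hxH, e, rfl, hjk, hvx⟩)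

open scoped Classical in
lemma exists_supports [Nonempty N] (k : ℝ) (v : N → M → ℝ) :
    ∃ f, Supports k v Set.univ f := by
  have : ∀ e, ∃ i, ∀ h, v h e = k → v i e = k := by
    intro e
    by_cases h : ∃ i, v i e = k
    · exact ⟨h.choose, fun _ _ => h.choose_spec⟩
    · exact ⟨Classical.arbitrary N, fun i hi => absurd ⟨i, hi⟩ h⟩
  choose f hf using this
  exact ⟨f, Set.univ_nonempty, fun e h _ hv => ⟨trivial, hf e h hv⟩, fun e h => absurd trivial h⟩

open scoped Classical in
/-- Some supported allocation has the equitability property up to the removal of any good. -/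
lemma exists_supports_equitable [Fintype N] [Fintype M] [Nonempty N] (hk : 1 < k)
    (hv : ∀ i e, v i e = 1 ∨ v i e = k) :
    ∃ H f, Supports k v H f ∧ ∀ i e, util v f (f e) - v (f e) e ≤ util v f i := by
  let low : (M → N) → ℝ := fun f => Finset.univ.inf' Finset.univ_nonempty (util v f)
  let poor : (M → N) → Finset N := fun f => Finset.univ.filter fun x => util v f x = low f
  let S : Finset (M → N) := Finset.univ.filter fun f => ∃ H, Supports k v H f
  obtain ⟨f₀, hf₀⟩ := exists_supports k v
  obtain ⟨f, hfS, hmax⟩ := Finset.exists_max_image S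
    (fun f => toLex (low f, OrderDual.toDual (poor f).card)) ⟨f₀, by simpa [S] using ⟨_, hf₀⟩⟩
  obtain ⟨H, hs⟩ : ∃ H, Supports k v H f := by simpa [S] using hfS
  refine ⟨H, f, hs, ?_⟩
  intro i e
  by_contra! hlt
  obtain ⟨m, -, hm⟩ := Finset.exists_mem_eq_inf' Finset.univ_nonempty (util v f)
  change low f = util v f m at hm
  have hle : ∀ x, low f ≤ util v f x := fun x => Finset.inf'_le _ (Finset.mem_univ x)
  obtain ⟨H', f', hs', hu⟩ := exists_improvement hk hv hs e m
  have hpos : 0 < v (f e) e := by rcases hv (f e) e with h | h <;> linarith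
  have hi := hle i
  have hge : ∀ x, low f ≤ util v f' x := by
    intro x
    have h1 := hu x
    have h2 := hle x
    by_cases hx : x = f e
    · subst hx
      simp only [if_true] at h1
      split_ifs at h1 <;> linarith
    · simp only [hx, if_false] at h1
      split_ifs at h1 <;> linarith
  have hmfe : m ≠ f e := by
    rintro rfl
    linarith
  have hlow : low f ≤ low f' := Finset.le_inf' _ _ fun x _ => hge x
  have hnot := hmax f' (by simpa [S] using ⟨H', hs'⟩)
  rw [Prod.Lex.toLex_le_toLex] at hnot
  rcases hnot with h | ⟨h, hcard⟩
  · exact absurd h (not_lt.2 hlow)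
  · simp only [OrderDual.toDual_le_toDual] at hcard
    simp only at h
    refine absurd hcard (not_le.2 (Finset.card_lt_card ?_))
    refine (Finset.ssubset_iff_of_subset ?_).2 ⟨m, ?_, ?_⟩
    · intro x hx
      simp only [poor, Finset.mem_filter, Finset.mem_univ, true_and] at hx ⊢
      have h1 := hu x
      have h2 := hle x
      by_cases hxe : x = f e
      · subst hxe
        simp only [if_true] at h1
        split_ifs at h1 <;> linarith
      · simp only [hxe, if_false] at h1
        split_ifs at h1 <;> linarith
    · simp [poor, hm]
    · simp only [poor, Finset.mem_filter, Finset.mem_univ, true_and]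
      have h1 := hu m
      simp only [hmfe, if_true, if_false] at h1
      intro h2
      linarith

open scoped Classical in
lemma sum_filter_eq_util [Fintype M] (f : M → N) (x : N) :
    ∑ e with f e = x, v x e = util v f x := by
  rw [util, Finset.sum_filter]

open scoped Classical in
lemma Supports.isfPO [Fintype N] [Fintype M] (hk : 1 < k) (hv : ∀ i e, v i e = 1 ∨ v i e = k)
    {H : Set N} {f : M → N} (hs : Supports k v H f) :
    IsfPO v fun x => Finset.univ.filter fun e => f e = x := by
  rintro ⟨x, ⟨hx, hx1⟩, hle, j, hlt⟩
  let w : N → ℝ := fun i => if i ∈ H then k else 1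
  have hw : ∀ i, 0 < w i := fun i => by
    simp only [w]
    split_ifs <;> linarith
  have hbest : ∀ i e, w i * v i e ≤ w (f e) * v (f e) e := by
    intro i e
    have hhigh := hs.high e i
    have hlow := hs.low e
    have hone := (hv (f e) e).elim (fun h => h.ge) (fun h => hk.le.trans h.ge)
    simp only [w]
    by_cases hi : i ∈ H <;> by_cases hf : f e ∈ H <;> rcases hv i e with h | h <;>
      simp only [hi, hf, if_true, if_false, h] at hhigh hlow ⊢ <;> first
      | nlinarith
      | simp_all
  have hlt' : ∑ i, w i * util v f i < ∑ i, w i * ∑ e, x i e * v i e := by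
    refine Finset.sum_lt_sum (fun i _ => ?_) ⟨j, Finset.mem_univ j, ?_⟩
    · rw [← sum_filter_eq_util]
      exact mul_le_mul_of_nonneg_left (hle i) (hw i).le
    · rw [← sum_filter_eq_util]
      exact mul_lt_mul_of_pos_left hlt (hw j)
  have hsum : ∑ i, w i * util v f i = ∑ e, w (f e) * v (f e) e := by
    simp only [util, Finset.mul_sum]
    rw [Finset.sum_comm]
    refine Finset.sum_congr rfl fun e _ => ?_
    simp
  have hle' : ∑ i, w i * ∑ e, x i e * v i e ≤ ∑ e, w (f e) * v (f e) e := by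
    simp only [Finset.mul_sum]
    rw [Finset.sum_comm]
    refine Finset.sum_le_sum fun e _ => ?_
    calc ∑ i, w i * (x i e * v i e) ≤ ∑ i, x i e * (w (f e) * v (f e) e) := by
          refine Finset.sum_le_sum fun i _ => ?_
          have := mul_le_mul_of_nonneg_left (hbest i e) (hx i e).1
          linarith
      _ = w (f e) * v (f e) e := by rw [← Finset.sum_mul, hx1, one_mul]
  linarith

end BivaluedEQX

/-- For every (unweighted) bivalued instance there exists an allocation that is
both EQX and fPO. -/
theorem eqx_fpo_exists {N M : Type*} [Fintype N] [Fintype M] [DecidableEq M] [Nonempty N]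
    (k : ℝ) (hk : 1 < k)
    (v : N → M → ℝ) (hv : ∀ i e, v i e = 1 ∨ v i e = k) :
    ∃ X : N → Finset M, IsAllocation X ∧
      (∀ i j : N, ∀ e ∈ X j, (∑ a ∈ (X j).erase e, v j a) ≤ ∑ a ∈ X i, v i a) ∧
      IsfPO v X := by
  classical
  obtain ⟨H, f, hs, heq⟩ := BivaluedEQX.exists_supports_equitable hk hv
  refine ⟨fun x => Finset.univ.filter fun e => f e = x, ⟨?_, ?_⟩, ?_, ?_⟩
  · intro i j hij
    rw [Finset.disjoint_left]
    intro e hi hj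
    simp only [Finset.mem_filter, Finset.mem_univ, true_and] at hi hj
    exact hij (hi.symm.trans hj)
  · exact fun e => ⟨f e, by simp⟩
  · intro i j e he
    have hfe : f e = j := by simpa using he
    have h1 := Finset.sum_erase_eq_sub (f := v j) he
    have h2 := heq i e
    rw [hfe] at h2
    have h3 := BivaluedEQX.sum_filter_eq_util (v := v) f i
    have h4 := BivaluedEQX.sum_filter_eq_util (v := v) f j
    calc _ = _ := by convert h1
      _ ≤ _ := by convert h2
  · convert hs.isfPO hk hv
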